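/- arXiv:2011.09312 — 8 statements merged into one kernel-verified Lean document; each statement's English description precedes it below -/
import Mathlib

section
/- Let X and Y be real Banach spaces, B : X × X → X a continuous bilinear map and T : Y → X a continuous linear map, and let Φ be a source-to-solution map defined on a neighbourhood B₁ of 0 in Y, i.e. for each f ∈ B₁ the element u = Φ(f) satisfies u = B(u,u) + T f, with Φ(0) = 0 and ‖Φ(f)‖ ≤ c‖f‖ on B₁ for some c > 0. Then Φ is Fréchet differentiable at 0 and its Fréchet derivative at 0 equals T; in particular, for every f ∈ Y, (Φ(εf) − Φ(0))/ε converges in X to T f as ε → 0. -/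
/-- First linearization of the Boltzmann source-to-solution map: if
`Φ f = B(Φ f, Φ f) + T f` on a neighbourhood `B₁` of `0`, `Φ 0 = 0` and `‖Φ f‖ ≤ c‖f‖`
on `B₁`, then `Φ` is Fréchet differentiable at `0` with derivative `T`; in particular
`(Φ(ε f) − Φ 0)/ε → T f` as `ε → 0` for every `f`. -/
theorem boltzmann_first_linearization
    {X Y : Type*} [NormedAddCommGroup X] [NormedSpace ℝ X] [CompleteSpace X]
    [NormedAddCommGroup Y] [NormedSpace ℝ Y] [CompleteSpace Y]
    (B : X →L[ℝ] X →L[ℝ] X) (T : Y →L[ℝ] X)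
    (B₁ : Set Y) (hB₁ : B₁ ∈ nhds (0 : Y)) (Φ : Y → X)
    (hΦ : ∀ f ∈ B₁, Φ f = B (Φ f) (Φ f) + T f) (hΦ0 : Φ 0 = 0)
    (c : ℝ) (hc : 0 < c) (hbound : ∀ f ∈ B₁, ‖Φ f‖ ≤ c * ‖f‖) :
    HasFDerivAt Φ T 0 ∧
    ∀ f : Y, Filter.Tendsto (fun ε : ℝ => ε⁻¹ • (Φ (ε • f) - Φ 0))
      (nhdsWithin (0 : ℝ) {0}ᶜ) (nhds (T f)) := by
  have hderiv : HasFDerivAt Φ T 0 := by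
    rw [hasFDerivAt_iff_isLittleO_nhds_zero]
    have hO : (fun h : Y => Φ (0 + h) - Φ 0 - T h) =O[nhds 0] fun h => ‖h‖ ^ 2 := by
      refine Asymptotics.IsBigO.of_bound (‖B‖ * c ^ 2) ?_
      filter_upwards [hB₁] with h hh
      have hrem : Φ (0 + h) - Φ 0 - T h = B (Φ h) (Φ h) := by
        rw [zero_add, hΦ0, sub_zero, sub_eq_iff_eq_add]
        exact hΦ h hh
      rw [hrem, norm_pow, norm_norm]
      calc ‖B (Φ h) (Φ h)‖ ≤ ‖B‖ * ‖Φ h‖ * ‖Φ h‖ := B.le_opNorm₂ _ _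
        _ ≤ ‖B‖ * (c * ‖h‖) * (c * ‖h‖) := by
          gcongr <;> exact hbound h hh
        _ = ‖B‖ * c ^ 2 * ‖h‖ ^ 2 := by ring
    exact hO.trans_isLittleO (Asymptotics.isLittleO_norm_pow_id one_lt_two)
  refine ⟨hderiv, fun f => ?_⟩
  simpa using (hderiv.hasLineDerivAt f).tendsto_slope_zero
end

section
/- Let X and Y be real Banach spaces, B : X × X → X a continuous bilinear map and T : Y → X a continuous linear map, and let Φ be a source-to-solution map defined on a neighbourhood B₁ of 0 in Y, i.e. for each f ∈ B₁ the element u = Φ(f) satisfies u = B(u,u) + T f, with ‖Φ(f)‖ ≤ c‖f‖ on B₁ for some c > 0. Then there exist ε > 0 and C > 0 such that ‖Φ(f) − T f − B(T f, T f)‖ ≤ C‖f‖³ for every f ∈ B₁ with ‖f‖ < ε. -/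
/-- A solution of `u = B(u, u) + v` agrees with `v + B(v, v)` up to a cubic error. -/
theorem norm_sub_sub_bilinear_le {X : Type*} [NormedAddCommGroup X] [NormedSpace ℝ X]
    (B : X →L[ℝ] X →L[ℝ] X) {u v : X} (h : u = B u u + v) :
    ‖u - v - B v v‖ ≤ ‖B‖ ^ 2 * ‖u‖ ^ 2 * (‖u‖ + ‖v‖) := by
  have hw : u - v = B u u := sub_eq_of_eq_add h
  have hsplit : u - v - B v v = B u (u - v) + B (u - v) v := by
    nth_rewrite 1 [hw]
    simp only [map_sub, sub_apply]
    abel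
  have hwn : ‖u - v‖ ≤ ‖B‖ * ‖u‖ * ‖u‖ := hw ▸ B.le_opNorm₂ u u
  calc ‖u - v - B v v‖ ≤ ‖B u (u - v)‖ + ‖B (u - v) v‖ := hsplit ▸ norm_add_le _ _
    _ ≤ ‖B‖ * ‖u‖ * ‖u - v‖ + ‖B‖ * ‖u - v‖ * ‖v‖ :=
      add_le_add (B.le_opNorm₂ _ _) (B.le_opNorm₂ _ _)
    _ = ‖B‖ * ‖u - v‖ * (‖u‖ + ‖v‖) := by ring
    _ ≤ ‖B‖ * (‖B‖ * ‖u‖ * ‖u‖) * (‖u‖ + ‖v‖) := by gcongr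
    _ = ‖B‖ ^ 2 * ‖u‖ ^ 2 * (‖u‖ + ‖v‖) := by ring

/-- Cubic remainder estimate (second-linearization step) for the Boltzmann
source-to-solution map: if `Φ f = B(Φ f, Φ f) + T f` on a neighbourhood `B₁` of `0` with
`‖Φ f‖ ≤ c‖f‖` there, then `‖Φ f − T f − B(T f, T f)‖ ≤ C ‖f‖³` for small `f ∈ B₁`. -/
theorem boltzmann_second_linearization_remainder
    {X Y : Type*} [NormedAddCommGroup X] [NormedSpace ℝ X] [CompleteSpace X]
    [NormedAddCommGroup Y] [NormedSpace ℝ Y] [CompleteSpace Y]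
    (B : X →L[ℝ] X →L[ℝ] X) (T : Y →L[ℝ] X)
    (B₁ : Set Y) (hB₁ : B₁ ∈ nhds (0 : Y)) (Φ : Y → X)
    (hΦ : ∀ f ∈ B₁, Φ f = B (Φ f) (Φ f) + T f)
    (c : ℝ) (hc : 0 < c) (hbound : ∀ f ∈ B₁, ‖Φ f‖ ≤ c * ‖f‖) :
    ∃ ε > (0 : ℝ), ∃ C > (0 : ℝ), ∀ f ∈ B₁, ‖f‖ < ε →
      ‖Φ f - T f - B (T f) (T f)‖ ≤ C * ‖f‖ ^ 3 := by
  refine ⟨1, one_pos, ‖B‖ ^ 2 * c ^ 2 * (c + ‖T‖) + 1, by positivity, fun f hf _ => ?_⟩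
  have hu := hbound f hf
  calc ‖Φ f - T f - B (T f) (T f)‖
      ≤ ‖B‖ ^ 2 * ‖Φ f‖ ^ 2 * (‖Φ f‖ + ‖T f‖) := norm_sub_sub_bilinear_le B (hΦ f hf)
    _ ≤ ‖B‖ ^ 2 * (c * ‖f‖) ^ 2 * (c * ‖f‖ + ‖T‖ * ‖f‖) := by
      gcongr
      exact T.le_opNorm f
    _ = ‖B‖ ^ 2 * c ^ 2 * (c + ‖T‖) * ‖f‖ ^ 3 := by ring
    _ ≤ (‖B‖ ^ 2 * c ^ 2 * (c + ‖T‖) + 1) * ‖f‖ ^ 3 := by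
      gcongr
      exact le_add_of_nonneg_right zero_le_one
end

section
/- Let X and Y be real Banach spaces, B : X × X → X a continuous bilinear map and T : Y → X a continuous linear map, and let Φ be the source-to-solution map of the equation u = B(u,u) + T f given by the implicit function theorem on a neighbourhood B₁ of 0 in Y (so Φ(f) = B(Φ(f),Φ(f)) + T f for f ∈ B₁ and Φ(0) = 0). Then Φ is twice Fréchet differentiable at 0, and its second Fréchet derivative at 0 satisfies D²Φ(0)(f,h) = B(T f, T h) + B(T h, T f) for all f, h ∈ Y. -/
/-- A solution branch of `u = B(u,u) + T f` that is continuous at the origin is `C^n` there. -/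
theorem contDiffAt_of_eventually_eq_bilinear_add
    {X Y : Type*} [NormedAddCommGroup X] [NormedSpace ℝ X] [CompleteSpace X]
    [NormedAddCommGroup Y] [NormedSpace ℝ Y] {n : WithTop ℕ∞} (hn : n ≠ 0)
    (B : X →L[ℝ] X →L[ℝ] X) (T : Y →L[ℝ] X) {Φ : Y → X}
    (hΦ : ∀ᶠ f in nhds (0 : Y), Φ f = B (Φ f) (Φ f) + T f) (hΦ0 : Φ 0 = 0)
    (hcont : ContinuousAt Φ 0) : ContDiffAt ℝ n Φ 0 := by
  let G : X → X := fun u => u - B u u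
  have hG : ContDiffAt ℝ n G 0 := by
    have : ContDiff ℝ n G := contDiff_id.sub (B.contDiff.clm_apply contDiff_id)
    exact this.contDiffAt
  have hG' : HasFDerivAt G ((ContinuousLinearEquiv.refl ℝ X : X ≃L[ℝ] X) : X →L[ℝ] X) 0 := by
    have h := (hasFDerivAt_id (𝕜 := ℝ) (0 : X)).sub
      ((B.hasFDerivAt (x := (0 : X))).clm_apply (hasFDerivAt_id (𝕜 := ℝ) (0 : X)))
    refine h.congr_fderiv ?_
    ext x
    simp
  have hG0 : G 0 = T 0 := by simp [G]
  have hinv : ContDiffAt ℝ n (hG.localInverse hG' hn) (T 0) :=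
    hG0 ▸ hG.to_localInverse hG' hn
  have hleft := (hG.hasStrictFDerivAt' hG' hn).eventually_left_inverse
  have hlim : Filter.Tendsto Φ (nhds 0) (nhds 0) := by simpa [ContinuousAt, hΦ0] using hcont
  refine (hinv.comp (0 : Y) T.contDiff.contDiffAt).congr_of_eventuallyEq ?_
  filter_upwards [hΦ, hlim.eventually hleft] with f hf hl
  have hGf : G (Φ f) = T f := sub_eq_of_eq_add' hf
  rw [hGf] at hl
  exact hl.symm


/-- Second Fréchet derivative of the Boltzmann source-to-solution map at the origin:
if `Φ` solves `Φ f = B(Φ f, Φ f) + T f` on a neighbourhood of `0`, with `Φ 0 = 0` and `Φ`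
continuous at `0` (so that `Φ` is the branch produced by the implicit function theorem),
then `Φ` is twice Fréchet differentiable at `0` and
`D²Φ(0)(f,h) = B(T f, T h) + B(T h, T f)`. -/
theorem boltzmann_second_derivative_at_zero
    {X Y : Type*} [NormedAddCommGroup X] [NormedSpace ℝ X] [CompleteSpace X]
    [NormedAddCommGroup Y] [NormedSpace ℝ Y] [CompleteSpace Y]
    (B : X →L[ℝ] X →L[ℝ] X) (T : Y →L[ℝ] X)
    (B₁ : Set Y) (hB₁ : B₁ ∈ nhds (0 : Y)) (Φ : Y → X)
    (hΦ : ∀ f ∈ B₁, Φ f = B (Φ f) (Φ f) + T f) (hΦ0 : Φ 0 = 0)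
    (hcont : ContinuousAt Φ 0) :
    (∀ᶠ f in nhds (0 : Y), DifferentiableAt ℝ Φ f) ∧
    DifferentiableAt ℝ (fderiv ℝ Φ) 0 ∧
    ∀ f h : Y, fderiv ℝ (fderiv ℝ Φ) 0 f h = B (T f) (T h) + B (T h) (T f) := by
  have heq : Φ =ᶠ[nhds 0] fun f => B (Φ f) (Φ f) + T f := Filter.eventually_of_mem hB₁ hΦ
  have hC : ContDiffAt ℝ 2 Φ 0 :=
    contDiffAt_of_eventually_eq_bilinear_add two_ne_zero B T heq hΦ0 hcont
  have hdiff : ∀ᶠ f in nhds (0 : Y), DifferentiableAt ℝ Φ f :=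
    (hC.eventually (by simp)).mono fun f hf => hf.differentiableAt two_ne_zero
  have hdiff2 : DifferentiableAt ℝ (fderiv ℝ Φ) 0 :=
    (hC.fderiv_right (m := 1) (by norm_num)).differentiableAt one_ne_zero
  refine ⟨hdiff, hdiff2, fun f h => ?_⟩
  have hfd : fderiv ℝ Φ =ᶠ[nhds 0]
      fun f => ((B + B.flip) (Φ f)).comp (fderiv ℝ Φ f) + T := by
    filter_upwards [heq.eventuallyEq_nhds, hdiff] with f hf hd
    have hq := ((B.hasFDerivAt.comp f hd.hasFDerivAt).clm_apply hd.hasFDerivAt).add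
      (T.hasFDerivAt (x := f))
    refine (hf.fderiv_eq.trans hq.fderiv).trans ?_
    ext x
    simp
  have hT : fderiv ℝ Φ 0 = T := by
    simpa [hΦ0] using hfd.eq_of_nhds
  have hA := (B + B.flip).hasFDerivAt.comp (0 : Y) hdiff.self_of_nhds.hasFDerivAt
  have hD := (hA.clm_comp hdiff2.hasFDerivAt).add_const T
  rw [hfd.fderiv_eq.trans hD.fderiv]
  simp [hΦ0, hT]
end

section
/- Let X and Y be real Banach spaces, B : X × X → X a continuous bilinear map and T : Y → X a continuous linear map, and let Φ be the source-to-solution map of the equation u = B(u,u) + T f given by the implicit function theorem on a neighbourhood B₁ of 0 in Y. Fix f, h ∈ Y and define, for (ε₁,ε₂) in a sufficiently small neighbourhood of (0,0) in ℝ², G(ε₁,ε₂) = Φ(ε₁ f + ε₂ h). Then the mixed second partial derivative ∂²G/∂ε₁∂ε₂ at (0,0) exists and equals B(T f, T h) + B(T h, T f). -/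
open Filter Topology

section QuadraticEquation

variable {X Y : Type*} [NormedAddCommGroup X] [NormedSpace ℝ X]
  [NormedAddCommGroup Y] [NormedSpace ℝ Y]
  {B : X →L[ℝ] X →L[ℝ] X} {T : Y →L[ℝ] X} {Φ : Y → X}

theorem hasFDerivAt_sub_quadratic_zero (B : X →L[ℝ] X →L[ℝ] X) :
    HasFDerivAt (fun u : X => u - B u u) ((ContinuousLinearEquiv.refl ℝ X : X ≃L[ℝ] X) : X →L[ℝ] X)
      0 := by
  have hB : HasFDerivAt (fun u : X => B u u) _ 0 :=
    B.hasFDerivAt_of_bilinear (hasFDerivAt_id (0 : X)) (hasFDerivAt_id (0 : X))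
  refine ((hasFDerivAt_id (0 : X)).sub hB).congr_fderiv ?_
  ext v
  simp

/-- A solution branch of `u = B(u,u) + T g` that is continuous at `0` and vanishes there is smooth
at `0`: it agrees near `0` with the local inverse of `u ↦ u - B(u,u)` composed with `T`. -/
theorem contDiffAt_quadratic_solution [CompleteSpace X]
    (hΦ : ∀ᶠ g in 𝓝 (0 : Y), Φ g = B (Φ g) (Φ g) + T g) (hΦ0 : Φ 0 = 0)
    (hcont : ContinuousAt Φ 0) : ContDiffAt ℝ 2 Φ 0 := by
  have hF : ContDiffAt ℝ 2 (fun u : X => u - B u u) 0 := by fun_prop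
  have hF' := hasFDerivAt_sub_quadratic_zero B
  have hinv : ContDiffAt ℝ 2 (hF.localInverse hF' two_ne_zero) (T 0) := by
    simpa using hF.to_localInverse hF' two_ne_zero
  have hleft : ∀ᶠ u in 𝓝 (0 : X), hF.localInverse hF' two_ne_zero (u - B u u) = u :=
    (hF.hasStrictFDerivAt' hF' two_ne_zero).eventually_left_inverse
  refine (hinv.comp (0 : Y) T.contDiff.contDiffAt).congr_of_eventuallyEq ?_
  have htend : Tendsto Φ (𝓝 0) (𝓝 0) := by simpa [ContinuousAt, hΦ0] using hcont
  filter_upwards [hΦ, htend.eventually hleft] with g hg hl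
  rw [sub_eq_of_eq_add' hg] at hl
  exact hl.symm

theorem fderiv_quadratic_solution {g : Y} (hd : DifferentiableAt ℝ Φ g)
    (hΦ : ∀ᶠ g' in 𝓝 g, Φ g' = B (Φ g') (Φ g') + T g') (v : Y) :
    fderiv ℝ Φ g v = B (fderiv ℝ Φ g v) (Φ g) + B (Φ g) (fderiv ℝ Φ g v) + T v := by
  have h := ((B.hasFDerivAt_of_bilinear hd.hasFDerivAt hd.hasFDerivAt).add
    T.hasFDerivAt).congr_of_eventuallyEq hΦ
  have h' := congrArg (fun L : Y →L[ℝ] X => L v) (hd.hasFDerivAt.unique h)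
  simpa [add_comm (B (Φ g) (fderiv ℝ Φ g v))] using h'

end QuadraticEquation

/-- Higher order linearization of the Boltzmann source-to-solution map: for fixed sources
`f, h`, the mixed second partial derivative `∂²/∂ε₁∂ε₂` of
`G(ε₁,ε₂) = Φ(ε₁ f + ε₂ h)` at `(0,0)` exists and equals `B(T f, T h) + B(T h, T f)`.
Here `Φ` solves `Φ g = B(Φ g, Φ g) + T g` near `0`, with `Φ 0 = 0` and `Φ` continuous at
`0` (the branch given by the implicit function theorem). -/
theorem boltzmann_mixed_second_partial
    {X Y : Type*} [NormedAddCommGroup X] [NormedSpace ℝ X] [CompleteSpace X]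
    [NormedAddCommGroup Y] [NormedSpace ℝ Y] [CompleteSpace Y]
    (B : X →L[ℝ] X →L[ℝ] X) (T : Y →L[ℝ] X)
    (B₁ : Set Y) (hB₁ : B₁ ∈ nhds (0 : Y)) (Φ : Y → X)
    (hΦ : ∀ g ∈ B₁, Φ g = B (Φ g) (Φ g) + T g) (hΦ0 : Φ 0 = 0)
    (hcont : ContinuousAt Φ 0) (f h : Y) :
    ∃ g₂ : ℝ → X,
      (∀ᶠ ε₁ in nhds (0 : ℝ),
        HasDerivAt (fun ε₂ : ℝ => Φ (ε₁ • f + ε₂ • h)) (g₂ ε₁) 0) ∧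
      HasDerivAt g₂ (B (T f) (T h) + B (T h) (T f)) 0 := by
  have hev : ∀ᶠ g in 𝓝 (0 : Y), Φ g = B (Φ g) (Φ g) + T g := by
    filter_upwards [hB₁] with g hg using hΦ g hg
  have hsmooth := contDiffAt_quadratic_solution hev hΦ0 hcont
  have hdiff : ∀ᶠ g in 𝓝 (0 : Y), DifferentiableAt ℝ Φ g :=
    (hsmooth.eventually (by simp)).mono fun g hg => hg.differentiableAt two_ne_zero
  have hfderiv (v : Y) : ∀ᶠ g in 𝓝 (0 : Y),
      fderiv ℝ Φ g v = B (fderiv ℝ Φ g v) (Φ g) + B (Φ g) (fderiv ℝ Φ g v) + T v := by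
    filter_upwards [hdiff, hev.eventually_nhds] with g hd hg
    exact fderiv_quadratic_solution hd hg v
  have hfderiv_zero (v : Y) : fderiv ℝ Φ 0 v = T v := by
    simpa [hΦ0] using (hfderiv v).self_of_nhds
  have hline (g v : Y) (t : ℝ) : HasDerivAt (fun s : ℝ => g + s • v) v t := by
    simpa using ((hasDerivAt_id t).smul_const v).const_add g
  have hray : HasDerivAt (fun s : ℝ => s • f) f 0 := by simpa using hline 0 f 0
  have htend : Tendsto (fun s : ℝ => s • f) (𝓝 0) (𝓝 0) := by
    simpa [ContinuousAt] using hray.continuousAt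
  refine ⟨fun s => fderiv ℝ Φ (s • f) h, ?_, ?_⟩
  · filter_upwards [htend.eventually hdiff] with s hs
    exact HasFDerivAt.comp_hasDerivAt_of_eq 0 hs.hasFDerivAt (hline (s • f) h 0) (by simp)
  · have hφ : HasDerivAt (fun s : ℝ => Φ (s • f)) (T f) 0 := by
      rw [← hfderiv_zero f]
      exact HasFDerivAt.comp_hasDerivAt_of_eq 0 hdiff.self_of_nhds.hasFDerivAt hray (by simp)
    have hψ : DifferentiableAt ℝ (fun s : ℝ => fderiv ℝ Φ (s • f) h) 0 := by
      have hD : DifferentiableAt ℝ (fderiv ℝ Φ) ((0 : ℝ) • f) := by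
        rw [zero_smul]
        exact (hsmooth.fderiv_right (m := 1) (by norm_num)).differentiableAt one_ne_zero
      exact (hD.comp (0 : ℝ) hray.differentiableAt).clm_apply (differentiableAt_const h)
    have hrhs := (((B.hasFDerivAt.comp_hasDerivAt (0 : ℝ) hψ.hasDerivAt).clm_apply hφ).add
      ((B.hasFDerivAt.comp_hasDerivAt (0 : ℝ) hφ).clm_apply hψ.hasDerivAt)).add_const (T h)
    have hres := hrhs.congr_of_eventuallyEq (htend.eventually (hfderiv h))
    simpa [hΦ0, hfderiv_zero, add_comm] using hres
end

section
/- Let X and Y be real Banach spaces, B : X × X → X a continuous bilinear map and T : Y → X a continuous linear map, and let Φ be a source-to-solution map on a neighbourhood B₁ of 0 in Y (so Φ(f) = B(Φ(f),Φ(f)) + T f for f ∈ B₁, Φ(0) = 0, and ‖Φ(f)‖ ≤ c‖f‖ on B₁ for some c > 0). Then for each fixed f ∈ Y the curve ε ↦ Φ(ε f), defined for small real ε, is twice differentiable at ε = 0, with first derivative T f and second derivative 2·B(T f, T f); equivalently Φ(ε f) = ε·T f + ε²·B(T f, T f) + O(ε³) in X as ε → 0. -/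
open Asymptotics

/-- A curve `u` tending to `0` with `u = B(u, u) + ε a` near `ε = 0` is smooth at `0`: it is the
image of the line `ε a` under the local inverse of `x ↦ x - B(x, x)`. -/
theorem contDiffAt_of_eq_bilinear_add_smul
    {X : Type*} [NormedAddCommGroup X] [NormedSpace ℝ X] [CompleteSpace X]
    (B : X →L[ℝ] X →L[ℝ] X) {u : ℝ → X} {a : X} {n : WithTop ℕ∞} (hn : n ≠ 0)
    (hu : ∀ᶠ ε in nhds (0 : ℝ), u ε = B (u ε) (u ε) + ε • a)
    (hlim : Filter.Tendsto u (nhds 0) (nhds 0)) : ContDiffAt ℝ n u 0 := by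
  let N : X → X := fun x => x - B x x
  have hN : ContDiffAt ℝ n N 0 :=
    contDiffAt_id.sub ((B.contDiff.contDiffAt).clm_apply contDiffAt_id)
  have hN' : HasFDerivAt N ((ContinuousLinearEquiv.refl ℝ X : X ≃L[ℝ] X) : X →L[ℝ] X) 0 := by
    have h := (hasFDerivAt_id (𝕜 := ℝ) (0 : X)).sub
      (B.hasFDerivAt.clm_apply (hasFDerivAt_id (𝕜 := ℝ) (0 : X)))
    refine h.congr_fderiv ?_
    ext x
    simp
  have hN0 : N 0 = 0 := by simp [N]
  have hinv : ContDiffAt ℝ n (hN.localInverse hN' hn) 0 := by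
    have h := hN.to_localInverse hN' hn
    rwa [hN0] at h
  have hline : ContDiffAt ℝ n (fun ε : ℝ => ε • a) 0 := contDiffAt_id.smul contDiffAt_const
  have hcomp : ContDiffAt ℝ n (fun ε : ℝ => hN.localInverse hN' hn (ε • a)) 0 := by
    refine ContDiffAt.comp (0 : ℝ) ?_ hline
    rwa [zero_smul]
  refine hcomp.congr_of_eventuallyEq ?_
  have hleft := (hN.hasStrictFDerivAt' hN' hn).eventually_left_inverse
  filter_upwards [hu, hlim.eventually hleft] with ε h₁ h₂
  have h₃ : N (u ε) = ε • a := sub_eq_of_eq_add' h₁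
  rw [← h₃]
  exact h₂.symm

/-- Second-order expansion of a curve `u = B(u, u) + ε a` with `u = O(ε)`. -/
theorem isBigO_sub_of_eq_bilinear_add_smul
    {X : Type*} [NormedAddCommGroup X] [NormedSpace ℝ X]
    (B : X →L[ℝ] X →L[ℝ] X) {u : ℝ → X} {a : X}
    (hu : ∀ᶠ ε in nhds (0 : ℝ), u ε = B (u ε) (u ε) + ε • a)
    (hO : u =O[nhds (0 : ℝ)] fun ε : ℝ => ε) :
    (fun ε : ℝ => u ε - ε • a - ε ^ 2 • B a a) =O[nhds (0 : ℝ)] fun ε : ℝ => ε ^ 3 := by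
  have hB {v w : ℝ → X} {p q : ℝ → ℝ} (hv : v =O[nhds (0 : ℝ)] p) (hw : w =O[nhds (0 : ℝ)] q) :
      (fun ε => B (v ε) (w ε)) =O[nhds (0 : ℝ)] fun ε => p ε * q ε :=
    (IsBigO.of_bound ‖B‖ (.of_forall fun ε => by
      simpa [mul_assoc] using B.le_opNorm₂ (v ε) (w ε))).trans (hv.norm_left.mul hw.norm_left)
  have hline : (fun ε : ℝ => ε • a) =O[nhds (0 : ℝ)] fun ε : ℝ => ε :=
    IsBigO.of_bound ‖a‖ (.of_forall fun ε => by rw [norm_smul, mul_comm])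
  have hfirst : (fun ε => u ε - ε • a) =O[nhds (0 : ℝ)] fun ε : ℝ => ε * ε :=
    (hB hO hO).congr' (hu.mono fun ε h => (sub_eq_of_eq_add h).symm) .rfl
  have hsum : (fun ε => B (u ε - ε • a) (u ε) + B (ε • a) (u ε - ε • a)) =O[nhds (0 : ℝ)]
      fun ε : ℝ => ε ^ 3 :=
    ((hB hfirst hO).congr_right fun ε => by ring).add
      ((hB hline hfirst).congr_right fun ε => by ring)
  refine hsum.congr' ?_ .rfl
  filter_upwards [hu] with ε h
  have hsq : u ε - ε • a = B (u ε) (u ε) := sub_eq_of_eq_add h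
  trans B (u ε) (u ε) - ε ^ 2 • B a a
  · simp only [map_sub, map_smul, sub_apply, smul_apply, pow_two]
    module
  · rw [hsq]

/-- One-parameter linearization of the Boltzmann source-to-solution map: for fixed `f`,
the curve `ε ↦ Φ(ε f)` is twice differentiable at `ε = 0` with first derivative `T f` and
second derivative `2 B(T f, T f)`; equivalently
`Φ(ε f) = ε T f + ε² B(T f, T f) + O(ε³)` as `ε → 0`. -/
theorem boltzmann_one_parameter_expansion
    {X Y : Type*} [NormedAddCommGroup X] [NormedSpace ℝ X] [CompleteSpace X]
    [NormedAddCommGroup Y] [NormedSpace ℝ Y] [CompleteSpace Y]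
    (B : X →L[ℝ] X →L[ℝ] X) (T : Y →L[ℝ] X)
    (B₁ : Set Y) (hB₁ : B₁ ∈ nhds (0 : Y)) (Φ : Y → X)
    (hΦ : ∀ g ∈ B₁, Φ g = B (Φ g) (Φ g) + T g) (hΦ0 : Φ 0 = 0)
    (c : ℝ) (hc : 0 < c) (hbound : ∀ g ∈ B₁, ‖Φ g‖ ≤ c * ‖g‖) (f : Y) :
    ∃ d : ℝ → X,
      (∀ᶠ ε in nhds (0 : ℝ), HasDerivAt (fun t : ℝ => Φ (t • f)) (d ε) ε) ∧
      d 0 = T f ∧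
      HasDerivAt d ((2 : ℝ) • B (T f) (T f)) 0 ∧
      (fun ε : ℝ => Φ (ε • f) - ε • T f - ε ^ 2 • B (T f) (T f)) =O[nhds (0 : ℝ)]
        fun ε : ℝ => ε ^ 3 := by
  have hsmul : Filter.Tendsto (fun ε : ℝ => ε • f) (nhds 0) (nhds 0) := by
    have h : Continuous fun ε : ℝ => ε • f := by fun_prop
    simpa using h.tendsto 0
  have hmem : ∀ᶠ ε in nhds (0 : ℝ), ε • f ∈ B₁ := hsmul hB₁
  set u : ℝ → X := fun ε => Φ (ε • f) with hu_def
  have hu0 : u 0 = 0 := by simp [u, hΦ0]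
  have hu : ∀ᶠ ε in nhds (0 : ℝ), u ε = B (u ε) (u ε) + ε • T f :=
    hmem.mono fun ε h => by simpa only [map_smul] using hΦ _ h
  have hO : u =O[nhds (0 : ℝ)] fun ε : ℝ => ε :=
    IsBigO.of_bound (c * ‖f‖) (hmem.mono fun ε h => (hbound _ h).trans_eq (by
      rw [norm_smul]; ring))
  have hC : ContDiffAt ℝ 2 u 0 :=
    contDiffAt_of_eq_bilinear_add_smul B two_ne_zero hu (hO.trans_tendsto Filter.tendsto_id)
  have hder : ∀ᶠ ε in nhds (0 : ℝ), HasDerivAt u (deriv u ε) ε :=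
    (hC.eventually (by simp)).mono fun ε h => (h.differentiableAt two_ne_zero).hasDerivAt
  have hdiff : HasDerivAt (deriv u) (deriv (deriv u) 0) 0 :=
    (((hC.fderiv_right (m := 1) (by norm_num)).differentiableAt one_ne_zero).clm_apply
      (differentiableAt_const (1 : ℝ))).hasDerivAt
  have heq : ∀ᶠ ε in nhds (0 : ℝ),
      deriv u ε = B (deriv u ε) (u ε) + B (u ε) (deriv u ε) + T f := by
    filter_upwards [hder, hu.eventually_nhds] with ε h h'
    have hrhs := ((B.hasFDerivAt.comp_hasDerivAt ε h).clm_apply h).add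
      ((hasDerivAt_id ε).smul_const (T f))
    simpa using (hrhs.congr_of_eventuallyEq h').unique h |>.symm
  have hd0 : deriv u 0 = T f := by simpa [hu0] using heq.self_of_nhds
  refine ⟨deriv u, hder, hd0, ?_, isBigO_sub_of_eq_bilinear_add_smul B hu hO⟩
  have hu' := hder.self_of_nhds
  have hrhs := (((B.hasFDerivAt.comp_hasDerivAt 0 hdiff).clm_apply hu').add
    ((B.hasFDerivAt.comp_hasDerivAt 0 hu').clm_apply hdiff)).add_const (T f)
  refine (hrhs.congr_of_eventuallyEq heq).congr_deriv ?_
  simp [hu0, hd0, two_smul]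
end

section
/- Let n ≥ 1 and let f : ℝⁿ × ℝⁿ → ℝ be infinitely differentiable with compact support. Then the transport solution u(x,p) = ∫_{−∞}^0 f(x + s·p, p) ds is infinitely differentiable on the open set ℝⁿ × (ℝⁿ \ {0}). -/
open MeasureTheory in
/-- If `f` is smooth with compact support, then its integral over the half-lines
`{x + s p | s ≤ 0}` is smooth in `(x, p)` as long as `x` stays bounded and `p` stays bounded away
from `0`: there, the integral is a convolution against the indicator function of `(-∞, 0]` of a
family of functions supported in a common compact interval. -/
theorem contDiffOn_integral_ray_of_bounded {E : Type*} [NormedAddCommGroup E] [NormedSpace ℝ E]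
    {f : E × E → ℝ} (hf : ContDiff ℝ (⊤ : ℕ∞) f) (hsupp : HasCompactSupport f)
    (R : ℝ) {ε : ℝ} (hε : 0 < ε) :
    ContDiffOn ℝ (⊤ : ℕ∞) (fun q : E × E => ∫ s in Set.Iic (0 : ℝ), f (q.1 + s • q.2, q.2))
      {q : E × E | ‖q.1‖ < R ∧ ε < ‖q.2‖} := by
  obtain ⟨C, hC⟩ := hsupp.isCompact.isBounded.exists_norm_le
  have hs : IsOpen {q : E × E | ‖q.1‖ < R ∧ ε < ‖q.2‖} :=
    (isOpen_lt continuous_fst.norm continuous_const).and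
      (isOpen_lt continuous_const continuous_snd.norm)
  have hloc : LocallyIntegrable ((Set.Iic (0 : ℝ)).indicator (fun _ => (1 : ℝ))) volume :=
    (locallyIntegrable_const 1).indicator measurableSet_Iic
  have hsmooth : ContDiff ℝ (⊤ : ℕ∞)
      (fun z : (E × E) × ℝ => f (z.1.1 - z.2 • z.1.2, z.1.2)) :=
    hf.comp (by fun_prop)
  have hsupp_ray : ∀ (q : E × E) (t : ℝ), q ∈ {q : E × E | ‖q.1‖ < R ∧ ε < ‖q.2‖} →
      t ∉ Metric.closedBall (0 : ℝ) ((R + C) / ε) → f (q.1 - t • q.2, q.2) = 0 := by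
    rintro q t ⟨hR, hq⟩ ht
    by_contra hne
    apply ht
    have hle : ‖q.1 - t • q.2‖ ≤ C :=
      (norm_fst_le (q.1 - t • q.2, q.2)).trans (hC _ (subset_tsupport f hne))
    have htri : ‖t • q.2‖ ≤ ‖q.1‖ + ‖q.1 - t • q.2‖ := by
      simpa using norm_sub_le q.1 (q.1 - t • q.2)
    rw [norm_smul] at htri
    rw [mem_closedBall_zero_iff, le_div_iff₀ hε]
    have := mul_le_mul_of_nonneg_left hq.le (norm_nonneg t)
    linarith
  have key := contDiffOn_convolution_right_with_param_comp (μ := volume) (n := ⊤)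
    (ContinuousLinearMap.mul ℝ ℝ) (v := fun _ : E × E => (0 : ℝ)) contDiffOn_const
    (g := fun (q : E × E) (t : ℝ) => f (q.1 - t • q.2, q.2)) hs
    (isCompact_closedBall (0 : ℝ) ((R + C) / ε)) hsupp_ray hloc hsmooth.contDiffOn
  refine key.congr fun q _ => ?_
  rw [convolution_def, ← integral_indicator measurableSet_Iic]
  refine integral_congr_ae (.of_forall fun t => ?_)
  by_cases ht : t ∈ Set.Iic (0 : ℝ) <;> simp [ht]

/-- Smoothness of the flat-space Vlasov solution: if `f` is smooth with compact support,
then `u(x,p) = ∫_{-∞}^0 f(x + s p, p) ds` is smooth on `ℝⁿ × (ℝⁿ \ {0})`. -/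
theorem vlasov_transport_solution_smooth
    (n : ℕ) (hn : 0 < n)
    (f : EuclideanSpace ℝ (Fin n) × EuclideanSpace ℝ (Fin n) → ℝ)
    (hf : ContDiff ℝ (⊤ : ℕ∞) f) (hsupp : HasCompactSupport f) :
    ContDiffOn ℝ (⊤ : ℕ∞)
      (fun q : EuclideanSpace ℝ (Fin n) × EuclideanSpace ℝ (Fin n) =>
        ∫ s in Set.Iic (0 : ℝ), f (q.1 + s • q.2, q.2))
      {q : EuclideanSpace ℝ (Fin n) × EuclideanSpace ℝ (Fin n) | q.2 ≠ 0} := by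
  intro q hq
  have hpos : 0 < ‖q.2‖ := norm_pos_iff.mpr hq
  refine ((contDiffOn_integral_ray_of_bounded hf hsupp (‖q.1‖ + 1) (half_pos hpos)).contDiffAt
    (IsOpen.mem_nhds ?_ ⟨lt_add_one _, half_lt_self hpos⟩)).contDiffWithinAt
  exact (isOpen_lt continuous_fst.norm continuous_const).and
    (isOpen_lt continuous_const continuous_snd.norm)
end

section
/- Let n ≥ 1, let K ⊂ ℝⁿ be a bounded set with diameter D, let R > 0, and let f : ℝⁿ × ℝⁿ → ℝ be a bounded continuous function such that f(y,q) = 0 whenever y ∉ K or ‖q‖ < R. Then for every x ∈ ℝⁿ and every p ≠ 0, the transport solution satisfies |∫_{−∞}^0 f(x + s·p, p) ds| ≤ (D/R)·sup |f|. -/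
/-- A line of speed `‖p‖ ≥ R > 0` spends time at most `diam K / R` in a bounded set `K`. -/
theorem ediam_preimage_line_le {E : Type*} [NormedAddCommGroup E] [NormedSpace ℝ E] {K : Set E}
    (hK : Bornology.IsBounded K) {R : ℝ} (hR : 0 < R) (x : E) {p : E} (hp : R ≤ ‖p‖) :
    Metric.ediam {s : ℝ | x + s • p ∈ K} ≤ ENNReal.ofReal (Metric.diam K / R) := by
  refine Metric.ediam_le fun s hs t ht => ?_
  rw [edist_dist]
  refine ENNReal.ofReal_le_ofReal ?_
  rw [le_div_iff₀ hR]
  calc dist s t * R ≤ dist s t * ‖p‖ := by gcongr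
    _ = dist (x + s • p) (x + t • p) := by
      rw [dist_add_left, dist_eq_norm (s • p), ← sub_smul, norm_smul, ← dist_eq_norm]
    _ ≤ Metric.diam K := Metric.dist_le_diam_of_mem hK hs ht

/-- A set integral of a function bounded by `C` and supported in a set of diameter at most `d`
has norm at most `C * d`. -/
theorem norm_setIntegral_le_of_ediam_support_le {g : ℝ → ℝ} {C d : ℝ} (hC : ∀ s, |g s| ≤ C)
    (hd : 0 ≤ d) (hg : Metric.ediam (Function.support g) ≤ ENNReal.ofReal d) {A : Set ℝ}
    (hA : MeasurableSet A) : |∫ s in A, g s| ≤ d * C := by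
  have hvol : MeasureTheory.volume (A ∩ Function.support g) ≤ ENNReal.ofReal d :=
    (MeasureTheory.measure_mono Set.inter_subset_right).trans ((Real.volume_le_diam _).trans hg)
  rw [MeasureTheory.setIntegral_eq_of_subset_of_forall_sdiff_eq_zero hA
    (Set.inter_subset_left (t := Function.support g)) fun s hs => by
      by_contra h
      exact hs.2 ⟨hs.1, h⟩, mul_comm, ← Real.norm_eq_abs]
  calc ‖∫ s in A ∩ Function.support g, g s‖
      ≤ C * MeasureTheory.volume.real (A ∩ Function.support g) :=
        MeasureTheory.norm_setIntegral_le_of_norm_le_const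
          (hvol.trans_lt ENNReal.ofReal_lt_top) fun s _ => hC s
    _ ≤ C * d := mul_le_mul_of_nonneg_left (ENNReal.toReal_le_of_le_ofReal hd hvol)
        ((abs_nonneg _).trans (hC 0))

/-- Sup-norm estimate for the flat-space Vlasov solution: if the bounded continuous
source `f` vanishes for base points outside a bounded set `K` of diameter `D` and for
velocities of norm `< R`, then the transport solution satisfies
`|∫_{-∞}^0 f(x + s p, p) ds| ≤ (D / R) · sup |f|`. -/
theorem vlasov_transport_solution_sup_bound
    (n : ℕ) (hn : 0 < n) (K : Set (EuclideanSpace ℝ (Fin n)))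
    (hK : Bornology.IsBounded K) (R : ℝ) (hR : 0 < R)
    (f : EuclideanSpace ℝ (Fin n) × EuclideanSpace ℝ (Fin n) → ℝ)
    (hf : Continuous f) (hbdd : ∃ M : ℝ, ∀ z, |f z| ≤ M)
    (hsupp : ∀ (y q : EuclideanSpace ℝ (Fin n)), y ∉ K ∨ ‖q‖ < R → f (y, q) = 0) :
    ∀ (x p : EuclideanSpace ℝ (Fin n)), p ≠ 0 →
      |∫ s in Set.Iic (0 : ℝ), f (x + s • p, p)| ≤
        (Metric.diam K / R) * ⨆ z, |f z| := by
  intro x p _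
  obtain ⟨M, hM⟩ := hbdd
  have hbd : BddAbove (Set.range fun z => |f z|) := ⟨M, by rintro _ ⟨z, rfl⟩; exact hM z⟩
  refine norm_setIntegral_le_of_ediam_support_le (fun s => le_ciSup hbd (x + s • p, p))
    (div_nonneg Metric.diam_nonneg hR.le) ?_ measurableSet_Iic
  by_cases hp : R ≤ ‖p‖
  · refine (Metric.ediam_mono fun s hs => ?_).trans (ediam_preimage_line_le hK hR x hp)
    by_contra h
    exact hs (hsupp _ _ (Or.inl h))
  · have h0 : Function.support (fun s : ℝ => f (x + s • p, p)) = ∅ :=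
      Function.support_eq_empty_iff.2
        (funext fun s => hsupp _ _ (Or.inr (not_le.1 hp)))
    simp [h0]
end

section
/- Let n ≥ 1 and K ⊂ ℝⁿ be compact. Define ℓ : ℝⁿ × (ℝⁿ \ {0}) → ℝ by ℓ(x,p) = sup({s ∈ [0,∞) : x − s·p ∈ K} ∪ {0}). Then: (i) ℓ is finite at every point (and equals the maximum of the set when {s ≥ 0 : x − s·p ∈ K} is nonempty); (ii) ℓ is upper semicontinuous on ℝⁿ × (ℝⁿ \ {0}); (iii) ℓ(x, λ·p) = λ⁻¹·ℓ(x,p) for every λ > 0; and (iv) ℓ attains a finite maximum on every compact subset of ℝⁿ × (ℝⁿ \ {0}). -/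
/-- The last exit time of the backward ray `s ↦ x − s p` from the compact set `K`. -/
noncomputable def exitTime {n : ℕ} (K : Set (EuclideanSpace ℝ (Fin n)))
    (x p : EuclideanSpace ℝ (Fin n)) : ℝ :=
  sSup ({s : ℝ | 0 ≤ s ∧ x - s • p ∈ K} ∪ {0})

section ExitTime

open Filter Topology Pointwise

variable {n : ℕ} {K : Set (EuclideanSpace ℝ (Fin n))} {x p : EuclideanSpace ℝ (Fin n)}

theorem le_div_norm_of_sub_smul_mem {M s : ℝ} (hM : ∀ y ∈ K, ‖y‖ ≤ M) (hp : p ≠ 0)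
    (hs : 0 ≤ s) (hsK : x - s • p ∈ K) : s ≤ (‖x‖ + M) / ‖p‖ := by
  rw [le_div_iff₀ (norm_pos_iff.2 hp)]
  calc s * ‖p‖ = ‖x - (x - s • p)‖ := by
        rw [sub_sub_cancel, norm_smul, Real.norm_of_nonneg hs]
    _ ≤ ‖x‖ + ‖x - s • p‖ := norm_sub_le _ _
    _ ≤ ‖x‖ + M := by gcongr; exact hM _ hsK

theorem bddAbove_exitTime_set (hK : IsCompact K) (hp : p ≠ 0) :
    BddAbove ({s : ℝ | 0 ≤ s ∧ x - s • p ∈ K} ∪ {0}) := by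
  obtain ⟨M, hM⟩ := hK.isBounded.exists_norm_le
  exact BddAbove.union ⟨_, fun s hs => le_div_norm_of_sub_smul_mem hM hp hs.1 hs.2⟩
    bddAbove_singleton

theorem isClosed_exitTime_set (hK : IsClosed K) :
    IsClosed {s : ℝ | 0 ≤ s ∧ x - s • p ∈ K} :=
  (isClosed_le continuous_const continuous_id).inter (hK.preimage (by fun_prop))

theorem exitTime_eq_sSup (hK : IsCompact K) (hp : p ≠ 0)
    (hne : {s : ℝ | 0 ≤ s ∧ x - s • p ∈ K}.Nonempty) :
    exitTime K x p = sSup {s : ℝ | 0 ≤ s ∧ x - s • p ∈ K} := by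
  have hb := (bddAbove_exitTime_set (x := x) hK hp).mono Set.subset_union_left
  rw [exitTime, csSup_union hb hne bddAbove_singleton (Set.singleton_nonempty 0),
    csSup_singleton]
  exact sup_eq_left.2 (Real.sSup_nonneg fun s hs => hs.1)

theorem exitTime_mem (hK : IsCompact K) (hp : p ≠ 0)
    (hne : {s : ℝ | 0 ≤ s ∧ x - s • p ∈ K}.Nonempty) :
    exitTime K x p ∈ {s : ℝ | 0 ≤ s ∧ x - s • p ∈ K} := by
  rw [exitTime_eq_sSup hK hp hne]
  exact (isClosed_exitTime_set hK.isClosed).csSup_mem hne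
    ((bddAbove_exitTime_set hK hp).mono Set.subset_union_left)

theorem exitTime_lt_iff (hK : IsCompact K) (hp : p ≠ 0) {y : ℝ} :
    exitTime K x p < y ↔ 0 < y ∧ ∀ s, y ≤ s → x - s • p ∉ K := by
  have hb := bddAbove_exitTime_set (x := x) hK hp
  constructor
  · intro h
    have hy : 0 < y := (le_csSup hb (Or.inr rfl)).trans_lt h
    exact ⟨hy, fun s hs hsK =>
      (h.trans_le hs).not_ge (le_csSup hb (Or.inl ⟨hy.le.trans hs, hsK⟩))⟩
  · rintro ⟨hy, h⟩
    rcases Set.eq_empty_or_nonempty {s : ℝ | 0 ≤ s ∧ x - s • p ∈ K} with he | hne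
    · simpa [exitTime, he] using hy
    · by_contra! hle
      exact h _ hle (exitTime_mem hK hp hne).2

theorem upperSemicontinuousOn_exitTime (hK : IsCompact K) :
    UpperSemicontinuousOn
      (fun q : EuclideanSpace ℝ (Fin n) × EuclideanSpace ℝ (Fin n) => exitTime K q.1 q.2)
      {q | q.2 ≠ 0} := by
  rintro ⟨x, p⟩ (hp : p ≠ 0) y hy
  obtain ⟨hy0, hyK⟩ := (exitTime_lt_iff hK hp).1 hy
  obtain ⟨M, hM⟩ := hK.isBounded.exists_norm_le
  set B := (‖x‖ + M) / ‖p‖ + 1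
  have hbound : ∀ᶠ q : EuclideanSpace ℝ (Fin n) × EuclideanSpace ℝ (Fin n) in 𝓝 (x, p),
      (‖q.1‖ + M) / ‖q.2‖ < B := by
    have hc : ContinuousAt (fun q : EuclideanSpace ℝ (Fin n) × EuclideanSpace ℝ (Fin n) =>
        (‖q.1‖ + M) / ‖q.2‖) (x, p) :=
      ContinuousAt.div (by fun_prop) (by fun_prop) (norm_ne_zero_iff.2 hp)
    exact hc.eventually_lt_const (lt_add_one _)
  have htube : ∀ᶠ q : EuclideanSpace ℝ (Fin n) × EuclideanSpace ℝ (Fin n) in 𝓝 (x, p),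
      ∀ s ∈ Set.Icc y B, q.1 - s • q.2 ∉ K := by
    refine isCompact_Icc.eventually_forall_of_forall_eventually fun s hs => ?_
    have hc : Continuous fun z : (EuclideanSpace ℝ (Fin n) × EuclideanSpace ℝ (Fin n)) × ℝ =>
        z.1.1 - z.2 • z.1.2 := by fun_prop
    exact (hK.isClosed.isOpen_compl.preimage hc).mem_nhds (hyK s hs.1)
  filter_upwards [nhdsWithin_le_nhds hbound, nhdsWithin_le_nhds htube, self_mem_nhdsWithin]
    with q hqB hqK hq
  exact (exitTime_lt_iff hK hq).2 ⟨hy0, fun s hs hsK => hqK s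
    ⟨hs, (le_div_norm_of_sub_smul_mem hM hq (hy0.le.trans hs) hsK).trans hqB.le⟩ hsK⟩

theorem exitTime_smul (K : Set (EuclideanSpace ℝ (Fin n))) (x p : EuclideanSpace ℝ (Fin n))
    {lam : ℝ} (hlam : 0 < lam) :
    exitTime K x (lam • p) = lam⁻¹ * exitTime K x p := by
  rw [exitTime, exitTime, ← smul_eq_mul, ← Real.sSup_smul_of_nonneg (inv_nonneg.2 hlam.le)]
  congr 1
  ext s
  rw [Set.mem_inv_smul_set_iff₀ hlam.ne']
  simp [hlam, hlam.ne', smul_smul, mul_comm]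

end ExitTime

/-- Properties of the exit time `ℓ(x,p) = sup({s ≥ 0 : x − s p ∈ K} ∪ {0})` for a compact
set `K ⊂ ℝⁿ`: (i) it is finite everywhere on `{p ≠ 0}` (the relevant set is bounded
above, and the supremum is attained when the set is nonempty); (ii) it is upper
semicontinuous on `ℝⁿ × (ℝⁿ \ {0})`; (iii) it is positively homogeneous of degree `−1`
in the velocity; (iv) it attains a finite maximum on every (nonempty) compact subset of
`ℝⁿ × (ℝⁿ \ {0})`. -/
theorem exitTime_properties
    (n : ℕ) (hn : 0 < n) (K : Set (EuclideanSpace ℝ (Fin n))) (hK : IsCompact K) :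
    (∀ (x p : EuclideanSpace ℝ (Fin n)), p ≠ 0 →
      BddAbove ({s : ℝ | 0 ≤ s ∧ x - s • p ∈ K} ∪ {0}) ∧
      ({s : ℝ | 0 ≤ s ∧ x - s • p ∈ K}.Nonempty →
        exitTime K x p ∈ {s : ℝ | 0 ≤ s ∧ x - s • p ∈ K})) ∧
    UpperSemicontinuousOn
      (fun q : EuclideanSpace ℝ (Fin n) × EuclideanSpace ℝ (Fin n) =>
        exitTime K q.1 q.2)
      {q : EuclideanSpace ℝ (Fin n) × EuclideanSpace ℝ (Fin n) | q.2 ≠ 0} ∧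
    (∀ (x p : EuclideanSpace ℝ (Fin n)) (lam : ℝ), p ≠ 0 → 0 < lam →
      exitTime K x (lam • p) = lam⁻¹ * exitTime K x p) ∧
    (∀ C : Set (EuclideanSpace ℝ (Fin n) × EuclideanSpace ℝ (Fin n)),
      IsCompact C → C.Nonempty → (∀ q ∈ C, q.2 ≠ 0) →
      ∃ z ∈ C, ∀ w ∈ C, exitTime K w.1 w.2 ≤ exitTime K z.1 z.2) := by
  refine ⟨fun x p hp => ⟨bddAbove_exitTime_set hK hp, exitTime_mem hK hp⟩,
    upperSemicontinuousOn_exitTime hK, fun x p lam _ hlam => exitTime_smul K x p hlam,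
    fun C hC hne hC0 => ?_⟩
  obtain ⟨z, hz, hmax⟩ :=
    ((upperSemicontinuousOn_exitTime hK).mono hC0).exists_isMaxOn hne hC
  exact ⟨z, hz, hmax⟩
end
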